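/- Let p = s/t with s, t coprime positive integers, 0 < s/t < 1, and s/t ≠ 1/2. Then the closed convex set {(x, y) ∈ ℝ² : x ≥ 0, y ≥ 0, yᵗ ≤ xˢ} (the scalar hypograph of x ↦ x^{s/t} on [0,∞)) is not a spectrahedron: there do not exist a positive integer ℓ and real symmetric ℓ×ℓ matrices A₀, A₁, A₂ such that this set equals {(x, y) ∈ ℝ² : A₀ + x A₁ + y A₂ is positive semidefinite}. -/

import Mathlib

open Matrix

namespace Matrix

open scoped ComplexOrder MatrixOrder

variable {n : Type*}

lemma IsHermitian.map_ofReal {A : Matrix n n ℝ} (hA : A.IsHermitian) :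
    (A.map Complex.ofRealHom).IsHermitian := by
  ext i j
  simpa using hA.apply i j

variable [Fintype n]

/-- If `M ± B` are positive semidefinite, the kernel of `M` is contained in that of `B`. -/
lemma mulVec_eq_zero_of_posSemidef_add_sub {M B : Matrix n n ℝ} (hadd : (M + B).PosSemidef)
    (hsub : (M - B).PosSemidef) {v : n → ℝ} (hv : M *ᵥ v = 0) : B *ᵥ v = 0 := by
  have h₁ := hadd.dotProduct_mulVec_nonneg v
  have h₂ := hsub.dotProduct_mulVec_nonneg v
  simp only [add_mulVec, sub_mulVec, hv, zero_add, zero_sub, dotProduct_neg] at h₁ h₂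
  have h := (hadd.dotProduct_mulVec_zero_iff v).1 (by
    rw [add_mulVec, hv, zero_add]; linarith)
  rwa [add_mulVec, hv, zero_add] at h

lemma mul_eq_zero_of_posSemidef_add_sub {M B Q : Matrix n n ℝ} (hadd : (M + B).PosSemidef)
    (hsub : (M - B).PosSemidef) (hQ : M * Q = 0) : B * Q = 0 := by
  ext i j
  have hcol : M *ᵥ Q.col j = 0 := by
    funext k
    exact congrFun (congrFun hQ k) j
  exact congrFun (mulVec_eq_zero_of_posSemidef_add_sub hadd hsub hcol) i

variable [DecidableEq n]

/-- Real spectral theorem, with the orthogonal change of basis written out. -/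
lemma IsHermitian.exists_diagonalization {A : Matrix n n ℝ} (hA : A.IsHermitian) :
    ∃ U : Matrix n n ℝ, Uᴴ * U = 1 ∧ U * Uᴴ = 1 ∧ A = U * diagonal hA.eigenvalues * Uᴴ := by
  refine ⟨hA.eigenvectorUnitary, ?_, ?_, ?_⟩
  · exact Unitary.coe_star_mul_self hA.eigenvectorUnitary
  · exact Unitary.coe_mul_star_self hA.eigenvectorUnitary
  · exact hA.spectral_theorem

lemma IsHermitian.posSemidef_sub_smul_one {A : Matrix n n ℝ} (hA : A.IsHermitian) {c : ℝ}
    (hc : ∀ i, c ≤ hA.eigenvalues i) : (A - c • (1 : Matrix n n ℝ)).PosSemidef := by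
  obtain ⟨U, -, hU, hAU⟩ := hA.exists_diagonalization
  have h : A - c • (1 : Matrix n n ℝ) = U * diagonal (fun i => hA.eigenvalues i - c) * Uᴴ := by
    rw [← diagonal_sub, mul_sub, sub_mul, ← hAU, ← smul_one_eq_diagonal, mul_smul_comm, smul_mul_assoc,
      mul_one, hU]
  rw [h]
  exact (PosSemidef.diagonal fun i => sub_nonneg.2 (hc i)).mul_mul_conjTranspose_same U

/-- Positive definiteness survives a small Hermitian perturbation (in semidefinite form). -/
lemma PosDef.exists_posSemidef_add_smul {A B : Matrix n n ℝ} (hA : A.PosDef)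
    (hB : B.IsHermitian) : ∃ ε : ℝ, 0 < ε ∧ (A + ε • B).PosSemidef := by
  obtain ⟨c, hc, hcA⟩ : ∃ c : ℝ, 0 < c ∧ ∀ i, c ≤ hA.1.eigenvalues i := by
    cases isEmpty_or_nonempty n
    · exact ⟨1, one_pos, fun i => isEmptyElim i⟩
    · obtain ⟨i, hi⟩ := Finite.exists_min hA.1.eigenvalues
      exact ⟨_, hA.eigenvalues_pos i, hi⟩
  obtain ⟨k, hk, hkB⟩ : ∃ k : ℝ, 0 < k ∧ ∀ i, -k ≤ hB.eigenvalues i := by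
    refine ⟨1 + ∑ i, |hB.eigenvalues i|, by positivity, fun i => ?_⟩
    have h := Finset.single_le_sum (fun j _ => abs_nonneg (hB.eigenvalues j)) (Finset.mem_univ i)
    linarith [neg_abs_le (hB.eigenvalues i)]
  refine ⟨c / k, div_pos hc hk, ?_⟩
  have h := (hA.1.posSemidef_sub_smul_one hcA).add
    ((hB.posSemidef_sub_smul_one hkB).smul (div_pos hc hk).le)
  have hck : c / k * k = c := div_mul_cancel₀ c hk.ne'
  convert h using 1
  rw [smul_sub, smul_smul, mul_neg, hck]
  module

/-- The orthogonal projection onto the kernel of a positive semidefinite matrix. -/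
lemma PosSemidef.exists_kernel_projection {H : Matrix n n ℝ} (hH : H.PosSemidef) :
    ∃ Q : Matrix n n ℝ, Q.IsHermitian ∧ Q * Q = Q ∧ H * Q = 0 ∧ (H + Q).PosDef := by
  obtain ⟨U, hU', hU, hHU⟩ := hH.1.exists_diagonalization
  set d := hH.1.eigenvalues
  have hmul (a b : n → ℝ) : (U * diagonal a * Uᴴ) * (U * diagonal b * Uᴴ)
      = U * diagonal (fun i => a i * b i) * Uᴴ := by
    rw [← diagonal_mul_diagonal]
    calc _ = U * diagonal a * (Uᴴ * U) * diagonal b * Uᴴ := by simp only [mul_assoc]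
      _ = _ := by rw [hU']; simp only [mul_assoc, mul_one]
  let e : n → ℝ := fun i => if d i = 0 then 1 else 0
  have he (i : n) : 0 ≤ e i := by simp only [e]; split_ifs <;> simp
  have hQ : (U * diagonal e * Uᴴ).PosSemidef :=
    (PosSemidef.diagonal he).mul_mul_conjTranspose_same U
  refine ⟨U * diagonal e * Uᴴ, hQ.1, ?_, ?_, ?_⟩
  · rw [hmul]
    congr 3
    funext i
    simp [e]
  · rw [hHU, hmul]
    have : (fun i => d i * e i) = fun _ => 0 := by funext i; simp [e]
    rw [this]
    simp
  · rw [(hH.add hQ).posDef_iff_det_ne_zero, hHU, ← add_mul, ← mul_add, diagonal_add, det_mul,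
      det_mul, mul_right_comm, ← det_mul, hU, det_one, one_mul, det_diagonal,
      Finset.prod_ne_zero_iff]
    intro i _
    by_cases h : d i = 0 <;> simp [e, h]

lemma PosDef.map_ofReal {A : Matrix n n ℝ} (hA : A.PosDef) :
    (A.map Complex.ofRealHom).PosDef := by
  obtain ⟨C, hC⟩ := CStarAlgebra.nonneg_iff_eq_star_mul_self.1 hA.posSemidef.nonneg
  have hmap : A.map Complex.ofRealHom
      = (C.map Complex.ofRealHom)ᴴ * C.map Complex.ofRealHom := by
    rw [hC, Matrix.map_mul, star_eq_conjTranspose]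
    congr 1
    ext i j
    simp
  have hpos : (A.map Complex.ofRealHom).PosSemidef := by
    rw [hmap]
    exact posSemidef_conjTranspose_mul_self _
  rw [hpos.posDef_iff_det_ne_zero]
  have hdet := RingHom.map_det Complex.ofRealHom A
  rw [RingHom.mapMatrix_apply] at hdet
  rw [← hdet]
  simpa using hA.det_pos.ne'

/-- A real symmetric pencil through a positive definite matrix is singular only at real
parameters. -/
lemma PosDef.det_add_smul_ne_zero {N V : Matrix n n ℝ} (hN : N.PosDef) (hV : V.IsHermitian)
    {z : ℂ} (hz : z.im ≠ 0) :
    (N.map Complex.ofRealHom + z • V.map Complex.ofRealHom).det ≠ 0 := by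
  intro hdet
  obtain ⟨w, hw, hker⟩ := exists_mulVec_eq_zero_iff.2 hdet
  have hpos := hN.map_ofReal.dotProduct_mulVec_pos hw
  have hVim := hV.map_ofReal.im_star_dotProduct_mulVec_self w
  have h := congrArg (star w ⬝ᵥ ·) hker
  simp only [add_mulVec, smul_mulVec, dotProduct_add, dotProduct_smul, dotProduct_zero] at h
  set a := star w ⬝ᵥ N.map Complex.ofRealHom *ᵥ w
  set b := star w ⬝ᵥ V.map Complex.ofRealHom *ᵥ w
  obtain ⟨hre, him⟩ := Complex.lt_def.1 hpos
  have h₁ := congrArg Complex.re h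
  have h₂ := congrArg Complex.im h
  simp only [RCLike.im_to_complex] at hVim
  simp only [Complex.zero_re, Complex.zero_im] at hre him
  simp only [smul_eq_mul, Complex.add_re, Complex.add_im, Complex.mul_re, Complex.mul_im, hVim,
    Complex.zero_re, Complex.zero_im, ← him, mul_zero, zero_add, sub_zero, mul_eq_zero, hz,
    false_or] at h₁ h₂
  rw [h₂, mul_zero] at h₁
  linarith

/-- If a real matrix curve `A + uᵗ B + uˢ C` is singular for all `u > 0`, it is singular for all
complex `u`. -/
lemma det_complex_curve_eq_zero {A B C : Matrix n n ℝ} {s t : ℕ}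
    (h : ∀ u : ℝ, 0 < u → (A + u ^ t • B + u ^ s • C).det = 0) (z : ℂ) :
    (A.map Complex.ofRealHom + z ^ t • B.map Complex.ofRealHom
      + z ^ s • C.map Complex.ofRealHom).det = 0 := by
  let p : Polynomial ℝ := (A.map Polynomial.C + (Polynomial.X : Polynomial ℝ) ^ t •
    B.map Polynomial.C + (Polynomial.X : Polynomial ℝ) ^ s • C.map Polynomial.C).det
  have hp : p = 0 := by
    refine p.eq_zero_of_infinite_isRoot ((Set.Ioi_infinite (0 : ℝ)).mono fun u hu => ?_)
    rw [Set.mem_ofPred_eq, Polynomial.IsRoot, ← Polynomial.coe_evalRingHom, RingHom.map_det,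
      ← h u hu]
    congr 1
    ext i j
    simp
    ring
  have hz : Polynomial.eval₂RingHom Complex.ofRealHom z p = 0 := by rw [hp, map_zero]
  rw [RingHom.map_det] at hz
  rw [← hz]
  congr 1
  ext i j
  simp
  ring

end Matrix

/-- For `s` coprime to `t ≥ 3`, some `t`-th root of unity has a nonreal `s`-th power. -/
lemma exists_pow_eq_one_im_pow_ne_zero {s t : ℕ} (hco : Nat.Coprime s t) (ht : 3 ≤ t) :
    ∃ z : ℂ, z ^ t = 1 ∧ (z ^ s).im ≠ 0 := by
  have hprim := Complex.isPrimitiveRoot_exp t (by omega)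
  refine ⟨_, hprim.pow_eq_one, fun him => ?_⟩
  have hs := hprim.pow_of_coprime s hco
  set w := Complex.exp (2 * Real.pi * Complex.I / t) ^ s
  have hw : w = (w.re : ℂ) := by apply Complex.ext <;> simp [him]
  have hpow : w.re ^ t = 1 := by
    have h := hs.pow_eq_one
    rw [hw] at h
    exact_mod_cast h
  have habs : |w.re| = 1 := by
    rw [← pow_eq_one_iff_of_nonneg (abs_nonneg _) (by omega : t ≠ 0), ← abs_pow, hpow, abs_one]
  have hsq : w ^ 2 = 1 := by
    rw [hw]
    exact_mod_cast (by rw [← sq_abs, habs, one_pow] : w.re ^ 2 = 1)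
  have := Nat.le_of_dvd two_pos (hs.dvd_of_pow_eq_one 2 hsq)
  omega

/-- Let `p = s/t` with `s, t` coprime positive integers, `0 < s/t < 1` and
`s/t ≠ 1/2`.  Then the scalar hypograph
`{(x, y) ∈ ℝ² : x ≥ 0, y ≥ 0, yᵗ ≤ xˢ}` of `x ↦ x^{s/t}` on `[0, ∞)` is not a
spectrahedron: it is not of the form
`{(x, y) : A₀ + x A₁ + y A₂ ⪰ 0}` for any real symmetric `ℓ × ℓ` matrices
`A₀, A₁, A₂`. -/
theorem scalar_power_hypograph_not_spectrahedron
    (s t : ℕ) (hs : 0 < s) (ht : 0 < t) (hco : Nat.Coprime s t)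
    (hlt : s < t) (hne : (s : ℚ) / t ≠ 1 / 2) :
    ¬ ∃ (l : ℕ), 0 < l ∧
      ∃ (A₀ A₁ A₂ : Matrix (Fin l) (Fin l) ℝ),
        A₀.IsHermitian ∧ A₁.IsHermitian ∧ A₂.IsHermitian ∧
        {v : ℝ × ℝ | 0 ≤ v.1 ∧ 0 ≤ v.2 ∧ v.2 ^ t ≤ v.1 ^ s}
          = {v : ℝ × ℝ | (A₀ + v.1 • A₁ + v.2 • A₂).PosSemidef} := by
  rintro ⟨l, -, A₀, A₁, A₂, h₀, h₁, h₂, hset⟩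
  have ht3 : 3 ≤ t := by
    by_contra! h
    obtain rfl : t = 2 := by omega
    obtain rfl : s = 1 := by omega
    norm_num at hne
  have hmem (x y : ℝ) : (0 ≤ x ∧ 0 ≤ y ∧ y ^ t ≤ x ^ s) ↔ (A₀ + x • A₁ + y • A₂).PosSemidef :=
    Set.ext_iff.1 hset (x, y)
  have hx (x : ℝ) (hx : 1 / 2 ≤ x) : (A₀ + x • A₁ + (1 / 2 : ℝ) • A₂).PosSemidef := by
    refine (hmem _ _).1 ⟨by linarith, by norm_num, ?_⟩
    calc (1 / 2 : ℝ) ^ t ≤ (1 / 2) ^ s :=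
          pow_le_pow_of_le_one (by norm_num) (by norm_num) hlt.le
      _ ≤ x ^ s := pow_le_pow_left₀ (by norm_num) hx s
  have hy (y : ℝ) (hy₀ : 0 ≤ y) (hy₁ : y ≤ 1) : (A₀ + (1 : ℝ) • A₁ + y • A₂).PosSemidef :=
    (hmem _ _).1 ⟨zero_le_one, hy₀, by rw [one_pow]; exact pow_le_one₀ hy₀ hy₁⟩
  obtain ⟨Q, hQ, hQQ, hHQ, hpd⟩ := (hx 1 (by norm_num)).exists_kernel_projection
  have hA₁ : A₁ * Q = 0 := by
    have h : ((1 / 2 : ℝ) • A₁) * Q = 0 :=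
      mul_eq_zero_of_posSemidef_add_sub (by convert hx (3 / 2) (by norm_num) using 1; module)
        (by convert hx (1 / 2) le_rfl using 1; module) hHQ
    simpa using h
  have hA₂ : A₂ * Q = 0 := by
    have h : ((1 / 2 : ℝ) • A₂) * Q = 0 :=
      mul_eq_zero_of_posSemidef_add_sub
        (by convert hy 1 zero_le_one le_rfl using 1; module)
        (by convert hy 0 le_rfl zero_le_one using 1; module) hHQ
    simpa using h
  have hA₀ : A₀ * Q = 0 := by simpa [add_mul, hA₁, hA₂] using hHQ
  have hMQ (x y : ℝ) : (A₀ + x • A₁ + y • A₂) * Q = 0 := by simp [add_mul, hA₀, hA₁, hA₂]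
  have hcurve (u : ℝ) (hu : 0 < u) : (A₀ + Q + u ^ t • A₁ + u ^ s • A₂).det = 0 := by
    by_contra hdet
    have hQpos : Q.PosSemidef := by
      have h := posSemidef_conjTranspose_mul_self Q
      rwa [hQ.eq, hQQ] at h
    have hpsd : (A₀ + Q + u ^ t • A₁ + u ^ s • A₂).PosSemidef := by
      have h := ((hmem (u ^ t) (u ^ s)).1
        ⟨by positivity, by positivity, by rw [← pow_mul, ← pow_mul, mul_comm]⟩).add hQpos
      convert h using 1
      module
    obtain ⟨ε, hε, hpert⟩ :=
      (hpsd.posDef_iff_det_ne_zero.2 hdet).exists_posSemidef_add_smul h₂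
    have hout : (A₀ + u ^ t • A₁ + (u ^ s + ε) • A₂).PosSemidef := by
      set M := A₀ + u ^ t • A₁ + (u ^ s + ε) • A₂ with hM
      have hMherm : M.IsHermitian :=
        (h₀.add (h₁.smul (.all _))).add (h₂.smul (.all _))
      have hMQ₀ : M * Q = 0 := hMQ _ _
      have hQM₀ : Q * M = 0 := by
        rw [← conjTranspose_zero, ← hMQ₀, conjTranspose_mul, hQ.eq, hMherm.eq]
      have hsplit : A₀ + Q + u ^ t • A₁ + u ^ s • A₂ + ε • A₂ = M + Q := by
        rw [hM]
        module
      rw [hsplit] at hpert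
      convert hpert.conjTranspose_mul_mul_same (1 - Q) using 1
      rw [conjTranspose_sub, conjTranspose_one, hQ.eq]
      simp [mul_sub, sub_mul, mul_add, hMQ₀, hQM₀, hQQ]
    have hle := ((hmem _ _).2 hout).2.2
    have hlt' : (u ^ s) ^ t < (u ^ s + ε) ^ t :=
      pow_lt_pow_left₀ (by linarith) (by positivity) (by omega)
    rw [← pow_mul] at hle hlt'
    rw [mul_comm] at hlt'
    exact absurd hle (not_le.2 hlt')
  obtain ⟨z, hzt, hzs⟩ := exists_pow_eq_one_im_pow_ne_zero hco ht3
  have hsing := det_complex_curve_eq_zero hcurve z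
  refine hpd.det_add_smul_ne_zero h₂ (z := z ^ s - 1 / 2) (by simpa using hzs) ?_
  rw [← hsing, hzt]
  congr 1
  ext i j
  simp
  ring
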